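/- Let w = w′ t_n^k with w′ ∈ Y_{d,n−1}^B and 0 ≤ k ≤ d−1, and let 0 ≤ m ≤ d−1. Then Tr_{n+1}(w e_n^{(m)}) = (E^{(k+m)}/x_k)·Tr_n(w), where E^{(j)} := (1/d) Σ_{s=0}^{d−1} x_{j+s} x_{d−s} (indices modulo d). In particular Tr_{n+1}(w e_n) = (E^{(k)}/x_k)·Tr_n(w). Similarly, if w = w′ b_n t_n^k with w′ ∈ Y_{d,n−1}^B, then Tr_{n+1}(w e_n^{(m)}) = (F^{(k+m)}/y_k)·Tr_n(w), where F^{(j)} := (1/d) Σ_{s=0}^{d−1} x_{d−s} y_{j+s}; in particular Tr_{n+1}(w e_n) = (F^{(k)}/y_k)·Tr_n(w). -/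

import Mathlib

set_option maxHeartbeats 1000000
set_option synthInstance.maxHeartbeats 400000

noncomputable section

/-- The field `L = ℂ(u,v,z)` of rational functions in three indeterminates over `ℂ`. -/
abbrev Kf : Type := FractionRing (MvPolynomial (Fin 3) ℂ)

/-- The indeterminate `u`. -/
def uu : Kf := algebraMap (MvPolynomial (Fin 3) ℂ) Kf (MvPolynomial.X 0)

/-- The indeterminate `v`. -/
def vv : Kf := algebraMap (MvPolynomial (Fin 3) ℂ) Kf (MvPolynomial.X 1)

/-- The indeterminate `z`. -/
def zz : Kf := algebraMap (MvPolynomial (Fin 3) ℂ) Kf (MvPolynomial.X 2)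

/-- Generators of the framization of the Hecke algebra of type B on `n` strands:
`b` is the generator `b₁`, `g i` is the braiding generator `g_{i+1}` (`i : Fin (n-1)`),
and `t j` is the framing generator `t_{j+1}` (`j : Fin n`). -/
inductive Gen (n : ℕ) : Type
  | b : Gen n
  | g : Fin (n - 1) → Gen n
  | t : Fin n → Gen n

/-- The free algebra on the generators. -/
abbrev FA (n : ℕ) : Type := FreeAlgebra Kf (Gen n)

/-- The generator `b₁` in the free algebra. -/
def Bb (n : ℕ) : FA n := FreeAlgebra.ι Kf Gen.b

/-- The generator `g_i` (for `1 ≤ i ≤ n-1`) in the free algebra; junk value `1` out of range. -/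
def Gg (n i : ℕ) : FA n :=
  if h : 1 ≤ i ∧ i ≤ n - 1 then FreeAlgebra.ι Kf (Gen.g ⟨i - 1, by omega⟩) else 1

/-- The generator `t_j` (for `1 ≤ j ≤ n`) in the free algebra; junk value `1` out of range. -/
def Tt (n j : ℕ) : FA n :=
  if h : 1 ≤ j ∧ j ≤ n then FreeAlgebra.ι Kf (Gen.t ⟨j - 1, by omega⟩) else 1

/-- The element `e_i = (1/d) ∑_{m=0}^{d-1} t_i^m t_{i+1}^{d-m}` in the free algebra. -/
def eF (d n i : ℕ) : FA n :=
  (d : Kf)⁻¹ • ∑ m ∈ Finset.range d, Tt n i ^ m * Tt n (i + 1) ^ (d - m)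

/-- The element `f₁ = (1/d) ∑_{m=0}^{d-1} t₁^m` in the free algebra. -/
def fF (d n : ℕ) : FA n :=
  (d : Kf)⁻¹ • ∑ m ∈ Finset.range d, Tt n 1 ^ m

/-- The action of the simple transposition `s_i` on indices: swaps `i` and `i+1`. -/
def sAct (i j : ℕ) : ℕ := if j = i then i + 1 else if j = i + 1 then i else j

/-- The defining relations of the framization `Y_{d,n}^B` of the Hecke algebra of type B. -/
inductive YBrel (d n : ℕ) : FA n → FA n → Prop
  | gg : ∀ i j : ℕ, 1 ≤ i → i ≤ n - 1 → 1 ≤ j → j ≤ n - 1 → (i + 1 < j ∨ j + 1 < i) →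
      YBrel d n (Gg n i * Gg n j) (Gg n j * Gg n i)
  | braid : ∀ i : ℕ, 1 ≤ i → i ≤ n - 2 →
      YBrel d n (Gg n i * Gg n (i + 1) * Gg n i) (Gg n (i + 1) * Gg n i * Gg n (i + 1))
  | bg : ∀ i : ℕ, 2 ≤ i → i ≤ n - 1 → YBrel d n (Bb n * Gg n i) (Gg n i * Bb n)
  | bgbg : YBrel d n (Bb n * Gg n 1 * Bb n * Gg n 1) (Gg n 1 * Bb n * Gg n 1 * Bb n)
  | tt : ∀ i j : ℕ, 1 ≤ i → i ≤ n → 1 ≤ j → j ≤ n →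
      YBrel d n (Tt n i * Tt n j) (Tt n j * Tt n i)
  | tg : ∀ i j : ℕ, 1 ≤ i → i ≤ n - 1 → 1 ≤ j → j ≤ n →
      YBrel d n (Tt n j * Gg n i) (Gg n i * Tt n (sAct i j))
  | tb : ∀ i : ℕ, 1 ≤ i → i ≤ n → YBrel d n (Tt n i * Bb n) (Bb n * Tt n i)
  | td : ∀ i : ℕ, 1 ≤ i → i ≤ n → YBrel d n (Tt n i ^ d) 1
  | gsq : ∀ i : ℕ, 1 ≤ i → i ≤ n - 1 →
      YBrel d n (Gg n i ^ 2) (1 + (uu - uu⁻¹) • (eF d n i * Gg n i))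
  | bsq : YBrel d n (Bb n ^ 2) (1 + (vv - vv⁻¹) • (fF d n * Bb n))

/-- The framization of the Hecke algebra of type B, `Y_{d,n}^B`. -/
abbrev YB (d n : ℕ) : Type := RingQuot (YBrel d n)

instance (d n : ℕ) : Ring (YB d n) := RingQuot.instRing (YBrel d n)

instance (d n : ℕ) : Algebra Kf (YB d n) := RingQuot.instAlgebra _

instance (d n : ℕ) : Module Kf (YB d n) := Algebra.toModule

/-- The canonical projection from the free algebra onto `Y_{d,n}^B`. -/
def mkY (d n : ℕ) : FA n →ₐ[Kf] YB d n := RingQuot.mkAlgHom Kf (YBrel d n)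

/-- The generator `b₁` of `Y_{d,n}^B`. -/
def bY (d n : ℕ) : YB d n := mkY d n (Bb n)

/-- The generator `g_i` of `Y_{d,n}^B`. -/
def gY (d n : ℕ) (i : ℕ) : YB d n := mkY d n (Gg n i)

/-- The generator `t_j` of `Y_{d,n}^B`. -/
def tY (d n : ℕ) (j : ℕ) : YB d n := mkY d n (Tt n j)

/-- The idempotent `e_i` of `Y_{d,n}^B`. -/
def eY (d n : ℕ) (i : ℕ) : YB d n := mkY d n (eF d n i)

/-- The idempotent `f₁` of `Y_{d,n}^B`. -/
def fY (d n : ℕ) : YB d n := mkY d n (fF d n)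

/-- The element `g_i⁻¹ = g_i - (u - u⁻¹) e_i`. -/
def gInv (d n i : ℕ) : YB d n := gY d n i - (uu - uu⁻¹) • eY d n i

/-- The elements `b_k := g_{k-1} ⋯ g_1 b_1 g_1⁻¹ ⋯ g_{k-1}⁻¹` for `2 ≤ k ≤ n`,
defined by `b_k = g_{k-1} b_{k-1} g_{k-1}⁻¹`; with `b_1` the generator `b₁`. -/
def bk (d n : ℕ) : ℕ → YB d n
  | 0 => 1
  | 1 => bY d n
  | (k + 2) => gY d n (k + 1) * bk d n (k + 1) * gInv d n (k + 1)

/-- The descending product `g_{k-1} g_{k-2} ⋯ g_j`. -/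
def gRange (d n j k : ℕ) : YB d n := (((List.range' j (k - j)).reverse).map (gY d n)).prod

/-- The elements `𝔪⁺_{k,j,m}`: `𝔪⁺_{k,k,m} = t_k^m` and
`𝔪⁺_{k,j,m} = g_{k-1} ⋯ g_j t_j^m` for `j < k`. -/
def mPlus (d n k j m : ℕ) : YB d n :=
  if j = k then tY d n k ^ m else gRange d n j k * tY d n j ^ m

/-- The elements `𝔪⁻_{k,j,m}`: `𝔪⁻_{k,k,m} = t_k^m b_k` and
`𝔪⁻_{k,j,m} = g_{k-1} ⋯ g_j b_j t_j^m` for `j < k`. -/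
def mMinus (d n k j m : ℕ) : YB d n :=
  if j = k then tY d n k ^ m * bk d n k else gRange d n j k * (bk d n j * tY d n j ^ m)

/-- The subsets `M_{d,k}` of `Y_{d,n}^B`:
`M_{d,1} = {t₁^m, t₁^m b₁}` and `M_{d,k} = {t_k^m, t_k^m b_k, g_{k-1} x : x ∈ M_{d,k-1}}`. -/
def Mset (d n : ℕ) : ℕ → Set (YB d n)
  | 0 => {1}
  | 1 => {x | ∃ m ≤ d - 1, x = tY d n 1 ^ m ∨ x = tY d n 1 ^ m * bY d n}
  | (k + 2) => {x |
      (∃ m ≤ d - 1, x = tY d n (k + 2) ^ m ∨ x = tY d n (k + 2) ^ m * bk d n (k + 2)) ∨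
      ∃ y ∈ Mset d n (k + 1), x = gY d n (k + 1) * y}

/-- The set `𝖢_n` of all products `𝔪_1 𝔪_2 ⋯ 𝔪_n` with `𝔪_i ∈ M_{d,i}`. -/
def Cset (d n : ℕ) : Set (YB d n) :=
  {x | ∃ f : Fin n → YB d n, (∀ i : Fin n, f i ∈ Mset d n (i.val + 1)) ∧
    x = (List.ofFn f).prod}

/-- Characterization of the natural inclusion `Y_{d,n}^B ⊆ Y_{d,n+1}^B`:
the algebra map sending generators to the generators of the same name. -/
def IsIncl (d n : ℕ) (inc : YB d n →ₐ[Kf] YB d (n + 1)) : Prop :=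
  inc (bY d n) = bY d (n + 1) ∧
  (∀ i, 1 ≤ i → i ≤ n - 1 → inc (gY d n i) = gY d (n + 1) i) ∧
  (∀ j, 1 ≤ j → j ≤ n → inc (tY d n j) = tY d (n + 1) j)

/-- Characterization of the relative trace `tr_{n+1} : Y_{d,n+1}^B → Y_{d,n}^B`
(with respect to trace parameters `x`, `y`): it is the `L`-linear map defined on the
basis `𝖢_{n+1}` by `tr(w t_{n+1}^m) = x_m w`, `tr(w b_{n+1} t_{n+1}^m) = y_m w`, and
`tr(w 𝔪^±_{n+1,k,m}) = z (w 𝔪^±_{n,k,m})` for `k < n+1`, where `w ∈ 𝖢_n`. -/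
def IsRelTrace (d : ℕ) (x y : ZMod d → Kf) (n : ℕ)
    (inc : YB d n →ₐ[Kf] YB d (n + 1)) (tr : YB d (n + 1) →ₗ[Kf] YB d n) : Prop :=
  ∀ w ∈ Cset d n, ∀ m : ℕ, m ≤ d - 1 →
    (tr (inc w * tY d (n + 1) (n + 1) ^ m) = x (m : ZMod d) • w) ∧
    (tr (inc w * (bk d (n + 1) (n + 1) * tY d (n + 1) (n + 1) ^ m)) = y (m : ZMod d) • w) ∧
    (∀ k, 1 ≤ k → k ≤ n →
      tr (inc w * mPlus d (n + 1) (n + 1) k m) = zz • (w * mPlus d n n k m) ∧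
      tr (inc w * mMinus d (n + 1) (n + 1) k m) = zz • (w * mMinus d n n k m))

/-- Characterization of the trace `tr_1 : Y_{d,1}^B → L`:
`tr_1(t₁^a) = x_a` and `tr_1(b₁ t₁^a) = y_a`. -/
def IsTr1 (d : ℕ) (x y : ZMod d → Kf) (tr1 : YB d 1 →ₗ[Kf] Kf) : Prop :=
  ∀ a : ℕ, a ≤ d - 1 →
    tr1 (tY d 1 1 ^ a) = x (a : ZMod d) ∧ tr1 (bY d 1 * tY d 1 1 ^ a) = y (a : ZMod d)

/-- The Markov trace tower `Tr_{m+1} = tr_1 ∘ tr_2 ∘ ⋯ ∘ tr_{m+1} : Y_{d,m+1}^B → L`,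
built from the relative traces (`tr k` here is the relative trace
`tr_{k+2} : Y_{d,k+2}^B → Y_{d,k+1}^B`). -/
def TrT (d : ℕ) (tr1 : YB d 1 →ₗ[Kf] Kf)
    (tr : (k : ℕ) → (YB d (k + 2) →ₗ[Kf] YB d (k + 1))) :
    (m : ℕ) → (YB d (m + 1) →ₗ[Kf] Kf)
  | 0 => tr1
  | (m + 1) => (TrT d tr1 tr m).comp (tr m)

/-- The element `e_n^{(m)} = (1/d) ∑_{s=0}^{d-1} t_n^{m+s} t_{n+1}^{d-s}` (at algebra
level `lvl`, with `j = n`); in particular `e_n = e_n^{(0)}`. -/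
def eGen (d lvl j m : ℕ) : YB d lvl :=
  (d : Kf)⁻¹ • ∑ s ∈ Finset.range d, tY d lvl j ^ (m + s) * tY d lvl (j + 1) ^ (d - s)

/-- The quantity `E^{(j)} = (1/d) ∑_{s=0}^{d-1} x_{j+s} x_{d-s}` (indices modulo `d`). -/
def Ecoef (d : ℕ) (x : ZMod d → Kf) (j : ZMod d) : Kf :=
  (d : Kf)⁻¹ * ∑ s ∈ Finset.range d, x (j + (s : ZMod d)) * x (((d - s : ℕ) : ZMod d))

/-- The quantity `F^{(j)} = (1/d) ∑_{s=0}^{d-1} x_{d-s} y_{j+s}` (indices modulo `d`). -/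
def Fcoef (d : ℕ) (x y : ZMod d → Kf) (j : ZMod d) : Kf :=
  (d : Kf)⁻¹ * ∑ s ∈ Finset.range d, x (((d - s : ℕ) : ZMod d)) * y (j + (s : ZMod d))

section Relations

variable {d n : ℕ}

theorem mkY_rel {a b : FA n} (h : YBrel d n a b) : mkY d n a = mkY d n b :=
  RingQuot.mkAlgHom_rel Kf h

theorem tY_commute (i j : ℕ) : Commute (tY d n i) (tY d n j) := by
  by_cases hi : 1 ≤ i ∧ i ≤ n
  · by_cases hj : 1 ≤ j ∧ j ≤ n
    · have h := mkY_rel (YBrel.tt (d := d) (n := n) i j hi.1 hi.2 hj.1 hj.2)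
      rw [map_mul, map_mul] at h
      exact h
    · have : tY d n j = 1 := by simp [tY, Tt, hj]
      rw [this]; exact Commute.one_right _
  · have : tY d n i = 1 := by simp [tY, Tt, hi]
    rw [this]; exact Commute.one_left _

theorem gY_commute {i j : ℕ} (hi : 1 ≤ i) (hin : i + 1 ≤ n) (hj : 1 ≤ j) (hjn : j + 1 ≤ n)
    (hij : i + 1 < j ∨ j + 1 < i) : Commute (gY d n i) (gY d n j) := by
  have h := mkY_rel (YBrel.gg (d := d) (n := n) i j hi (by omega) hj (by omega) hij)
  rw [map_mul, map_mul] at h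
  exact h

theorem gY_braid {i : ℕ} (hi : 1 ≤ i) (hin : i + 2 ≤ n) :
    gY d n i * gY d n (i + 1) * gY d n i = gY d n (i + 1) * gY d n i * gY d n (i + 1) := by
  have h := mkY_rel (YBrel.braid (d := d) (n := n) i hi (by omega))
  simp only [map_mul] at h
  exact h

theorem bY_commute_gY {i : ℕ} (hi : 2 ≤ i) (hin : i + 1 ≤ n) :
    Commute (bY d n) (gY d n i) := by
  have h := mkY_rel (YBrel.bg (d := d) (n := n) i hi (by omega))
  rw [map_mul, map_mul] at h
  exact h

theorem bY_gY_bY_gY :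
    bY d n * gY d n 1 * bY d n * gY d n 1 = gY d n 1 * bY d n * gY d n 1 * bY d n := by
  have h := mkY_rel (YBrel.bgbg (d := d) (n := n))
  simp only [map_mul] at h
  exact h

theorem tY_mul_gY {i j : ℕ} (hi : 1 ≤ i) (hin : i + 1 ≤ n) (hj : 1 ≤ j) (hjn : j ≤ n) :
    tY d n j * gY d n i = gY d n i * tY d n (sAct i j) := by
  have h := mkY_rel (YBrel.tg (d := d) (n := n) i j hi (by omega) hj hjn)
  simp only [map_mul] at h
  exact h

theorem tY_commute_bY (i : ℕ) : Commute (tY d n i) (bY d n) := by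
  by_cases hi : 1 ≤ i ∧ i ≤ n
  · have h := mkY_rel (YBrel.tb (d := d) (n := n) i hi.1 hi.2)
    rw [map_mul, map_mul] at h
    exact h
  · have : tY d n i = 1 := by simp [tY, Tt, hi]
    rw [this]; exact Commute.one_left _

theorem tY_pow_d (i : ℕ) : tY d n i ^ d = 1 := by
  by_cases hi : 1 ≤ i ∧ i ≤ n
  · have h := mkY_rel (YBrel.td (d := d) (n := n) i hi.1 hi.2)
    simp only [map_pow, map_one] at h
    exact h
  · have : tY d n i = 1 := by simp [tY, Tt, hi]
    rw [this, one_pow]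

theorem eY_eq (i : ℕ) : eY d n i =
    (d : Kf)⁻¹ • ∑ m ∈ Finset.range d, tY d n i ^ m * tY d n (i + 1) ^ (d - m) := by
  simp only [eY, eF, map_smul, map_sum, map_mul, map_pow, tY]

theorem fY_eq : fY d n = (d : Kf)⁻¹ • ∑ m ∈ Finset.range d, tY d n 1 ^ m := by
  simp only [fY, fF, map_smul, map_sum, map_pow, tY]

theorem gY_sq {i : ℕ} (hi : 1 ≤ i) (hin : i + 1 ≤ n) :
    gY d n i * gY d n i = 1 + (uu - uu⁻¹) • (eY d n i * gY d n i) := by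
  have h := mkY_rel (YBrel.gsq (d := d) (n := n) i hi (by omega))
  simp only [sq, map_add, map_one, map_smul, map_mul] at h
  exact h

theorem bY_sq : bY d n * bY d n = 1 + (vv - vv⁻¹) • (fY d n * bY d n) := by
  have h := mkY_rel (YBrel.bsq (d := d) (n := n))
  simp only [sq, map_add, map_one, map_smul, map_mul] at h
  exact h

theorem gY_mul_tY_succ {i : ℕ} (hi : 1 ≤ i) (hin : i + 1 ≤ n) :
    gY d n i * tY d n (i + 1) = tY d n i * gY d n i := by
  simpa [sAct] using (tY_mul_gY (d := d) hi hin hi (by omega)).symm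

theorem gY_mul_tY_self {i : ℕ} (hi : 1 ≤ i) (hin : i + 1 ≤ n) :
    gY d n i * tY d n i = tY d n (i + 1) * gY d n i := by
  simpa [sAct] using (tY_mul_gY (d := d) (j := i + 1) hi hin (by omega) hin).symm

theorem gY_commute_tY {i j : ℕ} (hi : 1 ≤ i) (hin : i + 1 ≤ n) (hj : j ≠ i)
    (hj' : j ≠ i + 1) : Commute (gY d n i) (tY d n j) := by
  by_cases h : 1 ≤ j ∧ j ≤ n
  · change gY d n i * tY d n j = tY d n j * gY d n i
    simpa [sAct, hj, hj'] using (tY_mul_gY (d := d) hi hin h.1 h.2).symm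
  · have : tY d n j = 1 := by simp [tY, Tt, h]
    rw [this]; exact Commute.one_right _

theorem gY_mul_tY_succ_pow {i : ℕ} (hi : 1 ≤ i) (hin : i + 1 ≤ n) (m : ℕ) :
    gY d n i * tY d n (i + 1) ^ m = tY d n i ^ m * gY d n i :=
  SemiconjBy.pow_right (gY_mul_tY_succ hi hin) m

theorem gY_mul_tY_self_pow {i : ℕ} (hi : 1 ≤ i) (hin : i + 1 ≤ n) (m : ℕ) :
    gY d n i * tY d n i ^ m = tY d n (i + 1) ^ m * gY d n i :=
  SemiconjBy.pow_right (gY_mul_tY_self hi hin) m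

theorem eY_eq_swap (i : ℕ) : eY d n i =
    (d : Kf)⁻¹ • ∑ m ∈ Finset.range d, tY d n (i + 1) ^ m * tY d n i ^ (d - m) := by
  rw [eY_eq]
  congr 1
  have h := Finset.sum_range_reflect
    (fun m => tY d n i ^ m * tY d n (i + 1) ^ (d - m)) (d + 1)
  rw [Finset.sum_range_succ, Finset.sum_range_succ] at h
  simp only [Nat.add_sub_cancel, Nat.sub_self, Nat.sub_zero, pow_zero, tY_pow_d,
    mul_one] at h
  rw [← add_right_cancel h]
  refine Finset.sum_congr rfl fun m hm => ?_
  rw [Finset.mem_range] at hm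
  rw [Nat.sub_sub_self hm.le]
  exact ((tY_commute _ _).pow_pow _ _).eq

theorem gY_commute_eY {i : ℕ} (hi : 1 ≤ i) (hin : i + 1 ≤ n) :
    Commute (gY d n i) (eY d n i) := by
  change gY d n i * eY d n i = eY d n i * gY d n i
  conv_rhs => rw [eY_eq]
  rw [eY_eq_swap, mul_smul_comm, smul_mul_assoc, Finset.mul_sum, Finset.sum_mul]
  congr 1
  refine Finset.sum_congr rfl fun m _ => ?_
  rw [← mul_assoc, gY_mul_tY_succ_pow hi hin, mul_assoc, gY_mul_tY_self_pow hi hin, mul_assoc]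

theorem gInv_mul_gY {i : ℕ} (hi : 1 ≤ i) (hin : i + 1 ≤ n) :
    gInv d n i * gY d n i = 1 := by
  rw [gInv, sub_mul, gY_sq hi hin, smul_mul_assoc, add_sub_cancel_right]

theorem gY_mul_gInv {i : ℕ} (hi : 1 ≤ i) (hin : i + 1 ≤ n) :
    gY d n i * gInv d n i = 1 := by
  rw [gInv, mul_sub, gY_sq hi hin, mul_smul_comm, (gY_commute_eY hi hin).eq,
    add_sub_cancel_right]

/-- A commutation `x g_i = g_i y` passes to the inverse of `g_i`. -/
theorem gInv_semiconj {i : ℕ} (hi : 1 ≤ i) (hin : i + 1 ≤ n) {x y : YB d n}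
    (h : gY d n i * y = x * gY d n i) : gInv d n i * x = y * gInv d n i := by
  calc gInv d n i * x = gInv d n i * x * (gY d n i * gInv d n i) := by
        rw [gY_mul_gInv hi hin, mul_one]
    _ = gInv d n i * (x * gY d n i) * gInv d n i := by simp only [mul_assoc]
    _ = gInv d n i * gY d n i * y * gInv d n i := by rw [← h]; simp only [mul_assoc]
    _ = y * gInv d n i := by rw [gInv_mul_gY hi hin, one_mul]

theorem gInv_mul_gInv_mul_gY {i : ℕ} (hi : 1 ≤ i) (hin : i + 2 ≤ n) :
    gInv d n i * gInv d n (i + 1) * gY d n i =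
      gY d n (i + 1) * (gInv d n i * gInv d n (i + 1)) := by
  have h1 : gY d n (i + 1) * gY d n i * (gInv d n i * gInv d n (i + 1)) = 1 := by
    rw [mul_assoc, ← mul_assoc (gY d n i), gY_mul_gInv hi (by omega), one_mul,
      gY_mul_gInv (by omega) hin]
  have h2 : gInv d n i * gInv d n (i + 1) * (gY d n (i + 1) * gY d n i) = 1 := by
    rw [mul_assoc, ← mul_assoc (gInv d n (i + 1)), gInv_mul_gY (by omega) hin, one_mul,
      gInv_mul_gY hi (by omega)]
  calc gInv d n i * gInv d n (i + 1) * gY d n i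
      = gInv d n i * gInv d n (i + 1) * gY d n i *
          (gY d n (i + 1) * gY d n i * (gInv d n i * gInv d n (i + 1))) := by rw [h1, mul_one]
    _ = gInv d n i * gInv d n (i + 1) * (gY d n i * gY d n (i + 1) * gY d n i) *
          (gInv d n i * gInv d n (i + 1)) := by simp only [mul_assoc]
    _ = gInv d n i * gInv d n (i + 1) * (gY d n (i + 1) * gY d n i) *
          (gY d n (i + 1) * (gInv d n i * gInv d n (i + 1))) := by
        rw [gY_braid hi hin]; simp only [mul_assoc]
    _ = gY d n (i + 1) * (gInv d n i * gInv d n (i + 1)) := by rw [h2, one_mul]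

theorem bk_one : bk d n 1 = bY d n := rfl

theorem bk_succ {k : ℕ} (hk : 1 ≤ k) :
    bk d n (k + 1) = gY d n k * bk d n k * gInv d n k := by
  obtain ⟨k, rfl⟩ := Nat.exists_eq_add_of_le' hk
  rfl

theorem bk_succ_mul_gY {k : ℕ} (hk : 1 ≤ k) (hkn : k + 1 ≤ n) :
    bk d n (k + 1) * gY d n k = gY d n k * bk d n k := by
  rw [bk_succ hk, mul_assoc, gInv_mul_gY hk hkn, mul_one]

theorem tY_commute_bk {k : ℕ} (hk : 1 ≤ k) (hkn : k ≤ n) :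
    ∀ i, Commute (tY d n i) (bk d n k) := by
  induction k, hk using Nat.le_induction with
  | base => exact fun i => tY_commute_bY i
  | succ k hk ih =>
    intro i
    have key : ∀ j, gY d n k * tY d n j = tY d n i * gY d n k →
        Commute (tY d n i) (bk d n (k + 1)) := by
      intro j hj
      change tY d n i * bk d n (k + 1) = bk d n (k + 1) * tY d n i
      rw [bk_succ hk, mul_assoc _ _ (tY d n i), gInv_semiconj hk hkn hj, ← mul_assoc, ← mul_assoc,
        ← hj, mul_assoc (gY d n k) (tY d n j), (ih (by omega) j).eq]
      simp only [mul_assoc]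
    by_cases h1 : i = k
    · subst h1; exact key _ (gY_mul_tY_succ hk hkn)
    by_cases h2 : i = k + 1
    · subst h2; exact key _ (gY_mul_tY_self hk hkn)
    exact key _ (gY_commute_tY hk hkn h1 h2)

theorem gY_commute_bk_of_lt {i k : ℕ} (hk : 1 ≤ k) (hki : k < i) (hin : i + 1 ≤ n) :
    Commute (gY d n i) (bk d n k) := by
  induction k, hk using Nat.le_induction with
  | base => exact (bY_commute_gY hki hin).symm
  | succ k hk ih =>
    have hc : Commute (gY d n i) (gY d n k) :=
      gY_commute (by omega) hin hk (by omega) (by omega)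
    have hc' : Commute (gY d n i) (gInv d n k) :=
      (gInv_semiconj hk (by omega) hc.symm.eq).symm
    rw [bk_succ hk]
    exact (hc.mul_right (ih (by omega))).mul_right hc'

theorem gY_commute_bk_of_succ_lt {i k : ℕ} (hi : 1 ≤ i) (hik : i + 1 < k) (hkn : k ≤ n) :
    Commute (gY d n i) (bk d n k) := by
  induction k, hik using Nat.le_induction with
  | base =>
    change gY d n i * bk d n (i + 1 + 1) = bk d n (i + 1 + 1) * gY d n i
    have hb := (gY_commute_bk_of_lt (d := d) hi (Nat.lt_succ_self i) hkn).eq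
    calc gY d n i * bk d n (i + 1 + 1)
        = gY d n i * gY d n (i + 1) * gY d n i * bk d n i * (gInv d n i * gInv d n (i + 1)) := by
          rw [bk_succ (by omega), bk_succ hi]; simp only [mul_assoc]
      _ = gY d n (i + 1) * gY d n i * (gY d n (i + 1) * bk d n i) *
            (gInv d n i * gInv d n (i + 1)) := by
          rw [gY_braid hi hkn]; simp only [mul_assoc]
      _ = gY d n (i + 1) * gY d n i * bk d n i *
            (gY d n (i + 1) * (gInv d n i * gInv d n (i + 1))) := by
          rw [hb]; simp only [mul_assoc]
      _ = gY d n (i + 1) * gY d n i * bk d n i *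
            (gInv d n i * gInv d n (i + 1) * gY d n i) := by
          rw [gInv_mul_gInv_mul_gY hi hkn]
      _ = bk d n (i + 1 + 1) * gY d n i := by
          rw [bk_succ (by omega), bk_succ hi]; simp only [mul_assoc]
  | succ k hk ih =>
    have hc : Commute (gY d n i) (gY d n k) :=
      gY_commute (by omega) (by omega) (by omega) (by omega) (by omega)
    have hc' : Commute (gY d n i) (gInv d n k) :=
      (gInv_semiconj (by omega) (by omega) hc.symm.eq).symm
    rw [bk_succ (by omega)]
    exact (hc.mul_right (ih (by omega))).mul_right hc'

end Relations
section DescendingProducts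

variable {d n : ℕ}

theorem gRange_self (j : ℕ) : gRange d n j j = 1 := by
  simp [gRange]

theorem gRange_succ {j k : ℕ} (h : j ≤ k) :
    gRange d n j (k + 1) = gY d n k * gRange d n j k := by
  rw [gRange, gRange, Nat.sub_add_comm h, List.range'_1_concat, Nat.add_sub_cancel' h]
  simp

theorem gRange_eq_mul_gY {j k : ℕ} (h : j < k) :
    gRange d n j k = gRange d n (j + 1) k * gY d n j := by
  induction k, h using Nat.le_induction with
  | base => rw [gRange_succ le_rfl, gRange_self, gRange_self, one_mul, mul_one]
  | succ k hk ih =>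
    rw [gRange_succ (by omega), ih, gRange_succ (by omega), mul_assoc]

/-- An element commuting with `g_j, …, g_{k-1}` commutes with their descending product. -/
theorem commute_gRange {x : YB d n} {j k : ℕ} (hjk : j ≤ k)
    (h : ∀ i, j ≤ i → i < k → Commute x (gY d n i)) : Commute x (gRange d n j k) := by
  induction k, hjk using Nat.le_induction with
  | base => rw [gRange_self]; exact Commute.one_right x
  | succ k hk ih =>
    rw [gRange_succ hk]
    exact (h k hk (by omega)).mul_right (ih fun i hi hik => h i hi (by omega))

theorem exists_gRange_mul_tY {i j k : ℕ} (hj : 1 ≤ j) (hjk : j ≤ k) (hkn : k ≤ n) (hi : 1 ≤ i)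
    (hik : i ≤ k) (hij : i ≠ j) :
    ∃ l, 1 ≤ l ∧ l + 1 ≤ k ∧ gRange d n j k * tY d n i = tY d n l * gRange d n j k := by
  induction k, hjk using Nat.le_induction with
  | base =>
    exact ⟨i, hi, by omega, by rw [gRange_self, one_mul, mul_one]⟩
  | succ k hk ih =>
    rw [gRange_succ hk]
    rcases hik.eq_or_lt with rfl | hlt
    · have hc : Commute (tY d n (k + 1)) (gRange d n j k) :=
        commute_gRange hk fun l hl hlk =>
          (gY_commute_tY (by omega) (by omega) (by omega) (by omega)).symm
      refine ⟨k, by omega, le_rfl, ?_⟩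
      rw [mul_assoc, ← hc.eq, ← mul_assoc, gY_mul_tY_succ (by omega) hkn, mul_assoc]
    · obtain ⟨l, hl, hlk, h⟩ := ih (by omega) (by omega)
      refine ⟨l, hl, by omega, ?_⟩
      rw [mul_assoc, h, ← mul_assoc,
        (gY_commute_tY (by omega) hkn (by omega) (by omega)).eq, mul_assoc]

theorem gRange_mul_gY {i j k : ℕ} (hj : 1 ≤ j) (hji : j ≤ i) (hik : i + 2 ≤ k) (hkn : k ≤ n) :
    gRange d n j k * gY d n (i + 1) = gY d n i * gRange d n j k := by
  induction k, hik using Nat.le_induction with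
  | base =>
    have hc : Commute (gY d n (i + 1)) (gRange d n j i) :=
      commute_gRange hji fun l hl hli =>
        gY_commute (by omega) (by omega) (by omega) (by omega) (by omega)
    rw [gRange_succ (by omega), gRange_succ hji, mul_assoc, mul_assoc, ← hc.eq]
    simp only [← mul_assoc]
    rw [gY_braid (by omega) hkn]
  | succ k hk ih =>
    have hc : Commute (gY d n k) (gY d n i) :=
      gY_commute (by omega) hkn (by omega) (by omega) (by omega)
    rw [gRange_succ (by omega), mul_assoc, ih (by omega), ← mul_assoc, hc.eq, mul_assoc]

end DescendingProducts

section Spanning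

variable {d n : ℕ}

/-- The elements acting on the right on a subspace of an algebra. -/
def rightStabilizer {K R : Type*} [CommRing K] [Ring R] [Algebra K R] (S : Submodule K R) :
    Subalgebra K R where
  carrier := {y | ∀ x ∈ S, x * y ∈ S}
  mul_mem' {a b} ha hb x hx := by rw [← mul_assoc]; exact hb _ (ha x hx)
  one_mem' x hx := by rwa [mul_one]
  add_mem' {a b} ha hb x hx := by rw [mul_add]; exact S.add_mem (ha x hx) (hb x hx)
  zero_mem' x _ := by rw [mul_zero]; exact S.zero_mem
  algebraMap_mem' r x hx := by
    rw [← Algebra.commutes, ← Algebra.smul_def]; exact S.smul_mem r hx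

theorem mem_rightStabilizer {K R : Type*} [CommRing K] [Ring R] [Algebra K R]
    {S : Submodule K R} {y : R} : y ∈ rightStabilizer S ↔ ∀ x ∈ S, x * y ∈ S :=
  Iff.rfl

/-- The span of the products `a g_{n-1} ⋯ g_j c t_j^m` with `a ∈ A` and `c ∈ {1, b_j}`. -/
def wordSpan (A : Subalgebra Kf (YB d n)) : Submodule Kf (YB d n) :=
  Submodule.span Kf {z | ∃ a ∈ A, ∃ (j m : ℕ) (c : YB d n), 1 ≤ j ∧ j ≤ n ∧
    (c = 1 ∨ c = bk d n j) ∧ z = a * (gRange d n j n * (c * tY d n j ^ m))}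

variable {A : Subalgebra Kf (YB d n)}

theorem word_mem {a : YB d n} (ha : a ∈ A) {j : ℕ} (m : ℕ) {c : YB d n} (hj : 1 ≤ j) (hjn : j ≤ n)
    (hc : c = 1 ∨ c = bk d n j) :
    a * (gRange d n j n * (c * tY d n j ^ m)) ∈ wordSpan A :=
  Submodule.subset_span ⟨a, ha, j, m, c, hj, hjn, hc, rfl⟩

theorem word_mem_one {j : ℕ} (m : ℕ) {c : YB d n} (hj : 1 ≤ j) (hjn : j ≤ n)
    (hc : c = 1 ∨ c = bk d n j) :
    gRange d n j n * (c * tY d n j ^ m) ∈ wordSpan A := by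
  simpa only [one_mul] using word_mem (one_mem A) m hj hjn hc

theorem mul_mem_wordSpan {a x : YB d n} (ha : a ∈ A) (hx : x ∈ wordSpan A) :
    a * x ∈ wordSpan A := by
  refine Submodule.span_induction ?_ ?_ ?_ ?_ hx
  · rintro _ ⟨a', ha', j, m, c, hj, hjn, hc, rfl⟩
    rw [← mul_assoc]
    exact word_mem (mul_mem ha ha') m hj hjn hc
  · rw [mul_zero]; exact zero_mem _
  · intro x y _ _ hx hy
    rw [mul_add]; exact add_mem hx hy
  · intro r x _ hx
    rw [mul_smul_comm]; exact Submodule.smul_mem _ r hx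

theorem mem_stabilizer_of_word {y : YB d n}
    (h : ∀ (j m : ℕ) (c : YB d n), 1 ≤ j → j ≤ n → (c = 1 ∨ c = bk d n j) →
      gRange d n j n * (c * tY d n j ^ m) * y ∈ wordSpan A) :
    y ∈ rightStabilizer (wordSpan A) := by
  intro x hx
  refine Submodule.span_induction ?_ ?_ ?_ ?_ hx
  · rintro _ ⟨a, ha, j, m, c, hj, hjn, hc, rfl⟩
    rw [mul_assoc]
    exact mul_mem_wordSpan ha (h j m c hj hjn hc)
  · rw [zero_mul]; exact zero_mem _
  · intro x y _ _ hx hy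
    rw [add_mul]; exact add_mem hx hy
  · intro r x _ hx
    rw [smul_mul_assoc]; exact Submodule.smul_mem _ r hx

theorem tY_mem_stabilizer (ht : ∀ i, 1 ≤ i → i + 1 ≤ n → tY d n i ∈ A) (i : ℕ) :
    tY d n i ∈ rightStabilizer (wordSpan A) := by
  by_cases hi : 1 ≤ i ∧ i ≤ n
  swap
  · have : tY d n i = 1 := by simp [tY, Tt, hi]
    rw [this]; exact one_mem _
  refine mem_stabilizer_of_word fun j m c hj hjn hc => ?_
  by_cases hij : i = j
  · subst hij
    rw [mul_assoc, mul_assoc, ← pow_succ]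
    exact word_mem_one (m + 1) hj hjn hc
  · have hcomm : Commute (tY d n i) (c * tY d n j ^ m) := by
      refine Commute.mul_right ?_ ((tY_commute i j).pow_right m)
      rcases hc with rfl | rfl
      · exact Commute.one_right _
      · exact tY_commute_bk hj hjn i
    obtain ⟨l, hl, hln, h⟩ := exists_gRange_mul_tY (d := d) hj hjn le_rfl hi.1 hi.2 hij
    rw [mul_assoc, ← hcomm.eq, ← mul_assoc, h, mul_assoc]
    exact word_mem (ht l hl hln) m hj hjn hc

theorem eY_mem_of_tY_mem {B : Subalgebra Kf (YB d n)} (ht : ∀ i, tY d n i ∈ B) (i : ℕ) :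
    eY d n i ∈ B := by
  rw [eY_eq]
  exact B.smul_mem (B.sum_mem fun m _ => mul_mem (pow_mem (ht _) _) (pow_mem (ht _) _)) _

theorem fY_mem_of_tY_mem {B : Subalgebra Kf (YB d n)} (ht : ∀ i, tY d n i ∈ B) :
    fY d n ∈ B := by
  rw [fY_eq]
  exact B.smul_mem (B.sum_mem fun m _ => pow_mem (ht _) _) _

theorem gY_mem_stabilizer (hg : ∀ i, 1 ≤ i → i + 2 ≤ n → gY d n i ∈ A)
    (ht : ∀ i, 1 ≤ i → i + 1 ≤ n → tY d n i ∈ A) (i : ℕ) :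
    gY d n i ∈ rightStabilizer (wordSpan A) := by
  by_cases hi : 1 ≤ i ∧ i ≤ n - 1
  swap
  · have : gY d n i = 1 := by simp only [gY, Gg, hi, dif_neg, not_false_eq_true, map_one]
    rw [this]; exact one_mem _
  obtain ⟨hi, hin⟩ := hi
  have hts := tY_mem_stabilizer ht
  refine mem_stabilizer_of_word fun j m c hj hjn hc => ?_
  rcases lt_trichotomy i j with hlt | rfl | hgt
  · rcases (Nat.succ_le_of_lt hlt).eq_or_lt with rfl | hlt
    · have hcg : ∃ c', (c' = 1 ∨ c' = bk d n i) ∧ c * gY d n i = gY d n i * c' := by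
        rcases hc with rfl | rfl
        · exact ⟨1, Or.inl rfl, by rw [one_mul, mul_one]⟩
        · exact ⟨_, Or.inr rfl, bk_succ_mul_gY hi hjn⟩
      obtain ⟨c', hc', hcc⟩ := hcg
      have := word_mem_one (A := A) m hi (by omega) hc'
      rw [gRange_eq_mul_gY (by omega), mul_assoc, ← mul_assoc (gY d n i), ← hcc, mul_assoc c,
        gY_mul_tY_self_pow hi hjn, ← mul_assoc c, ← mul_assoc] at this
      exact this
    · have hcomm : Commute (gY d n i) (gRange d n j n * (c * tY d n j ^ m)) := by
        refine Commute.mul_right (commute_gRange hjn fun l hl hln =>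
          gY_commute hi (by omega) (by omega) (by omega) (by omega)) (Commute.mul_right ?_
            ((gY_commute_tY hi (by omega) (by omega) (by omega)).pow_right m))
        rcases hc with rfl | rfl
        · exact Commute.one_right _
        · exact gY_commute_bk_of_succ_lt hi hlt hjn
      rw [← hcomm.eq]
      exact word_mem (hg i hi (by omega)) m hj hjn hc
  · have hcg : gY d n i * c * gInv d n i = 1 ∨ gY d n i * c * gInv d n i = bk d n (i + 1) := by
      rcases hc with rfl | rfl
      · exact Or.inl (by rw [mul_one, gY_mul_gInv hi (by omega)])
      · exact Or.inr (bk_succ hi).symm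
    have hgi : gY d n i = gInv d n i + (uu - uu⁻¹) • eY d n i := by
      rw [gInv, sub_add_cancel]
    have key : gRange d n i n * (c * tY d n i ^ m) * gY d n i =
        gRange d n (i + 1) n * ((gY d n i * c * gInv d n i) * tY d n (i + 1) ^ m) +
          (uu - uu⁻¹) •
            (gRange d n i n * (c * tY d n i ^ 0) * (eY d n i * tY d n (i + 1) ^ m)) := by
      have h1 : c * tY d n i ^ m * gY d n i = c * gInv d n i * tY d n (i + 1) ^ m +
          (uu - uu⁻¹) • (c * (eY d n i * tY d n (i + 1) ^ m)) := by
        rw [mul_assoc, ← gY_mul_tY_succ_pow hi (by omega), hgi, add_mul, mul_add, smul_mul_assoc,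
          mul_smul_comm, mul_assoc]
      rw [mul_assoc, h1, mul_add, mul_smul_comm, pow_zero, mul_one, mul_assoc (gRange d n i n) c]
      congr 1
      rw [gRange_eq_mul_gY (by omega)]
      simp only [mul_assoc]
    rw [key]
    refine add_mem (word_mem_one m (by omega) (by omega) hcg) (Submodule.smul_mem _ _ ?_)
    exact mem_rightStabilizer.1 (mul_mem (eY_mem_of_tY_mem hts i) (pow_mem (hts _) m)) _
      (word_mem_one 0 hj hjn hc)
  · obtain ⟨i, rfl⟩ := Nat.exists_eq_add_of_le' hi
    have hcomm : Commute (gY d n (i + 1)) (c * tY d n j ^ m) := by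
      refine Commute.mul_right ?_
        ((gY_commute_tY hi (by omega) (by omega) (by omega)).pow_right m)
      rcases hc with rfl | rfl
      · exact Commute.one_right _
      · exact gY_commute_bk_of_lt hj hgt (by omega)
    rw [mul_assoc, ← hcomm.eq, ← mul_assoc, gRange_mul_gY hj (by omega) (by omega) le_rfl,
      mul_assoc]
    exact word_mem (hg i (by omega) (by omega)) m hj hjn hc

theorem gRange_bk_mul_bY_mem (hb : 2 ≤ n → bY d n ∈ A)
    (hgs : ∀ i, gY d n i ∈ rightStabilizer (wordSpan A))
    (hts : ∀ i, tY d n i ∈ rightStabilizer (wordSpan A)) {j : ℕ} (hj : 1 ≤ j) (hjn : j ≤ n) :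
    gRange d n j n * (bk d n j * bY d n) ∈ wordSpan A := by
  have hes := eY_mem_of_tY_mem hts
  have hword : ∀ j, 1 ≤ j → j ≤ n → gRange d n j n * bk d n j ∈ wordSpan A := fun j hj hjn => by
    simpa only [pow_zero, mul_one] using word_mem_one (A := A) 0 hj hjn (Or.inr rfl)
  induction j, hj using Nat.le_induction with
  | base =>
    have hfb : Commute (fY d n) (bY d n) := by
      rw [fY_eq]
      exact ((Commute.sum_left _ _ _ fun m _ => (tY_commute_bY 1).pow_left m)).smul_left _
    rw [bk_one, bY_sq, hfb.eq, mul_add, mul_smul_comm, ← mul_assoc]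
    refine add_mem ?_ (Submodule.smul_mem _ _
      (mem_rightStabilizer.1 (fY_mem_of_tY_mem hts) _ (hword 1 le_rfl hjn)))
    simpa only [pow_zero, mul_one] using word_mem_one (A := A) 0 le_rfl hjn (Or.inl rfl)
  | succ j hj ih =>
    have ih := ih (by omega)
    rcases hj.eq_or_lt with rfl | hlt
    · have heb : Commute (eY d n 1) (bY d n) := by
        rw [eY_eq]
        exact (Commute.sum_left _ _ _ fun m _ => ((tY_commute_bY 1).pow_left m).mul_left
          ((tY_commute_bY _).pow_left _)).smul_left _
      have hbR : Commute (bY d n) (gRange d n 2 n) :=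
        commute_gRange hjn fun i hi hin => bY_commute_gY hi (by omega)
      have key : gRange d n 2 n * (bk d n 2 * bY d n) =
          bY d n * (gRange d n 1 n * bk d n 1 * gY d n 1) -
            (uu - uu⁻¹) • (gRange d n 1 n * (bk d n 1 * bY d n) * eY d n 1) := by
        have h1 : bk d n 2 * bY d n = bY d n * gY d n 1 * bY d n * gY d n 1 -
            (uu - uu⁻¹) • (gY d n 1 * (bY d n * bY d n) * eY d n 1) := by
          rw [bY_gY_bY_gY, bk_succ le_rfl, bk_one, gInv, mul_sub, sub_mul, mul_smul_comm,
            smul_mul_assoc]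
          simp only [mul_assoc, heb.eq]
        rw [h1, mul_sub, mul_smul_comm, gRange_eq_mul_gY (j := 1) (by omega), bk_one]
        simp only [← mul_assoc]
        rw [hbR.eq]
      rw [key]
      exact sub_mem (mul_mem_wordSpan (hb hjn) (hgs 1 _ (hword 1 le_rfl (by omega))))
        (Submodule.smul_mem _ _ (hes 1 _ ih))
    · have hcomm : Commute (gInv d n j) (bY d n) :=
        gInv_semiconj hj hjn (bY_commute_gY hlt hjn).symm.eq
      have hinv : gInv d n j ∈ rightStabilizer (wordSpan A) :=
        sub_mem (hgs j) (Subalgebra.smul_mem _ (hes j) _)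
      have key : gRange d n (j + 1) n * (bk d n (j + 1) * bY d n) =
          gRange d n j n * (bk d n j * bY d n) * gInv d n j := by
        rw [bk_succ hj, gRange_eq_mul_gY (j := j) (by omega)]
        simp only [mul_assoc, hcomm.eq]
      rw [key]
      exact hinv _ ih

theorem bY_mem_stabilizer (hb : 2 ≤ n → bY d n ∈ A)
    (hg : ∀ i, 1 ≤ i → i + 2 ≤ n → gY d n i ∈ A)
    (ht : ∀ i, 1 ≤ i → i + 1 ≤ n → tY d n i ∈ A) :
    bY d n ∈ rightStabilizer (wordSpan A) := by
  have hts := tY_mem_stabilizer ht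
  refine mem_stabilizer_of_word fun j m c hj hjn hc => ?_
  have hcomm := ((tY_commute_bY (d := d) (n := n) j).pow_left m).eq
  rcases hc with rfl | rfl
  · rw [one_mul, mul_assoc, hcomm]
    rcases hj.eq_or_lt with rfl | hlt
    · exact word_mem_one m le_rfl hjn (Or.inr rfl)
    · have hbR : Commute (bY d n) (gRange d n j n) :=
        commute_gRange hjn fun i hi hin => bY_commute_gY (by omega) (by omega)
      rw [← mul_assoc, ← hbR.eq, mul_assoc]
      simpa only [one_mul] using word_mem (hb (by omega)) m hj hjn (Or.inl rfl)
  · rw [mul_assoc, mul_assoc, hcomm, ← mul_assoc (bk d n j), ← mul_assoc]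
    exact mem_rightStabilizer.1 (pow_mem (hts j) m) _
      (gRange_bk_mul_bY_mem hb (gY_mem_stabilizer hg ht) hts hj hjn)

/-- A subalgebra containing all generators is everything. -/
theorem mem_of_generators_mem {B : Subalgebra Kf (YB d n)} (hb : bY d n ∈ B)
    (hg : ∀ i, gY d n i ∈ B) (ht : ∀ i, tY d n i ∈ B) (x : YB d n) : x ∈ B := by
  obtain ⟨a, rfl⟩ : ∃ a, mkY d n a = x := RingQuot.mkAlgHom_surjective Kf (YBrel d n) x
  refine FreeAlgebra.induction Kf (Gen n) (motive := fun a => mkY d n a ∈ B) ?_ ?_ ?_ ?_ a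
  · intro r
    rw [AlgHom.commutes]; exact B.algebraMap_mem r
  · rintro (_ | i | i)
    · exact hb
    · have h := hg (i + 1)
      simp only [gY, Gg] at h
      rw [dif_pos ⟨by omega, by omega⟩] at h
      exact h
    · have h := ht (i + 1)
      simp only [tY, Tt] at h
      rw [dif_pos ⟨by omega, by omega⟩] at h
      exact h
  · intro a b ha hb
    rw [map_mul]; exact mul_mem ha hb
  · intro a b ha hb
    rw [map_add]; exact add_mem ha hb

theorem wordSpan_eq_top (hn : 1 ≤ n) (hb : 2 ≤ n → bY d n ∈ A)
    (hg : ∀ i, 1 ≤ i → i + 2 ≤ n → gY d n i ∈ A)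
    (ht : ∀ i, 1 ≤ i → i + 1 ≤ n → tY d n i ∈ A) : wordSpan A = ⊤ := by
  refine Submodule.eq_top_iff'.2 fun x => ?_
  have hx := mem_of_generators_mem (bY_mem_stabilizer hb hg ht) (gY_mem_stabilizer hg ht)
    (tY_mem_stabilizer ht) x
  have h1 : (1 : YB d n) ∈ wordSpan A := by
    simpa only [gRange_self, pow_zero, mul_one] using
      word_mem_one (A := A) 0 hn le_rfl (Or.inl rfl)
  simpa only [one_mul] using hx 1 h1

end Spanning
section StandardBasis

variable {d n : ℕ}

theorem tY_pow_mod (i m : ℕ) : tY d n i ^ (m % d) = tY d n i ^ m :=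
  (pow_eq_pow_mod m (tY_pow_d i)).symm

theorem tY_pow_mem_Mset (hd : 1 ≤ d) {j : ℕ} (m : ℕ) {c : YB d n} (hj : 1 ≤ j) (hjn : j ≤ n)
    (hc : c = 1 ∨ c = bk d n j) : c * tY d n j ^ m ∈ Mset d n j := by
  have hm : m % d ≤ d - 1 := Nat.le_sub_one_of_lt (Nat.mod_lt m hd)
  have h : ∃ m' ≤ d - 1, c * tY d n j ^ m = tY d n j ^ m' ∨
      c * tY d n j ^ m = tY d n j ^ m' * bk d n j := by
    refine ⟨m % d, hm, ?_⟩
    rw [tY_pow_mod]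
    rcases hc with rfl | rfl
    · exact Or.inl (one_mul _)
    · exact Or.inr ((tY_commute_bk hj hjn j).pow_left m).eq.symm
  obtain ⟨j, rfl⟩ := Nat.exists_eq_add_of_le' hj
  cases j with
  | zero => exact h
  | succ j => exact Or.inl h

theorem word_mem_Mset (hd : 1 ≤ d) {j k : ℕ} (m : ℕ) {c : YB d n} (hj : 1 ≤ j) (hjk : j ≤ k)
    (hkn : k ≤ n) (hc : c = 1 ∨ c = bk d n j) :
    gRange d n j k * (c * tY d n j ^ m) ∈ Mset d n k := by
  induction k, hjk using Nat.le_induction with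
  | base =>
    rw [gRange_self, one_mul]
    exact tY_pow_mem_Mset hd m hj hkn hc
  | succ k hk ih =>
    obtain ⟨k, rfl⟩ := Nat.exists_eq_add_of_le' (hj.trans hk)
    exact Or.inr ⟨_, ih (by omega), by rw [gRange_succ hk, mul_assoc]⟩

variable {inc : YB d n →ₐ[Kf] YB d (n + 1)}

theorem IsIncl.map_gInv (h : IsIncl d n inc) {i : ℕ} (hi : 1 ≤ i) (hin : i + 1 ≤ n) :
    inc (gInv d n i) = gInv d (n + 1) i := by
  simp only [gInv, eY_eq, map_sub, map_smul, map_sum, map_mul, map_pow]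
  rw [h.2.1 i hi (by omega), h.2.2 i hi (by omega), h.2.2 (i + 1) (by omega) hin]

theorem IsIncl.map_bk (h : IsIncl d n inc) {k : ℕ} (hk : 1 ≤ k) (hkn : k ≤ n) :
    inc (bk d n k) = bk d (n + 1) k := by
  induction k, hk using Nat.le_induction with
  | base => exact h.1
  | succ k hk ih =>
    rw [bk_succ hk, bk_succ hk, map_mul, map_mul, ih (by omega), h.map_gInv hk hkn,
      h.2.1 k hk (by omega)]

theorem IsIncl.map_mem_Mset (h : IsIncl d n inc) {k : ℕ} (hk : 1 ≤ k) (hkn : k ≤ n)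
    {x : YB d n} (hx : x ∈ Mset d n k) : inc x ∈ Mset d (n + 1) k := by
  induction k, hk using Nat.le_induction generalizing x with
  | base =>
    obtain ⟨m, hm, rfl | rfl⟩ := hx
    · exact ⟨m, hm, Or.inl (by rw [map_pow, h.2.2 1 le_rfl hkn])⟩
    · exact ⟨m, hm, Or.inr (by rw [map_mul, map_pow, h.2.2 1 le_rfl hkn, h.1])⟩
  | succ k hk ih =>
    obtain ⟨k, rfl⟩ := Nat.exists_eq_add_of_le' hk
    obtain ⟨m, hm, rfl | rfl⟩ | ⟨y, hy, rfl⟩ := hx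
    · exact Or.inl ⟨m, hm, Or.inl (by rw [map_pow, h.2.2 _ (by omega) hkn])⟩
    · exact Or.inl ⟨m, hm, Or.inr (by
        rw [map_mul, map_pow, h.2.2 _ (by omega) hkn, h.map_bk (by omega) hkn])⟩
    · exact Or.inr ⟨inc y, ih (by omega) hy, by
        rw [map_mul, h.2.1 (k + 1) (by omega) (by omega)]⟩

theorem IsIncl.map_mul_mem_Cset (h : IsIncl d n inc) {x : YB d n} (hx : x ∈ Cset d n)
    {y : YB d (n + 1)} (hy : y ∈ Mset d (n + 1) (n + 1)) : inc x * y ∈ Cset d (n + 1) := by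
  obtain ⟨f, hf, rfl⟩ := hx
  refine ⟨Fin.snoc (α := fun _ => YB d (n + 1)) (fun i => inc (f i)) y, fun i => ?_, ?_⟩
  · refine Fin.lastCases ?_ (fun i => ?_) i
    · rw [Fin.snoc_last]; exact hy
    · rw [Fin.snoc_castSucc]
      exact h.map_mem_Mset (by omega) (by simp only [Fin.val_castSucc]; omega) (hf i)
  · rw [List.ofFn_succ', List.concat_eq_append, List.prod_append, List.prod_singleton,
      Fin.snoc_last, map_list_prod, List.map_ofFn]
    simp only [Fin.snoc_castSucc]
    rfl

theorem span_Cset_one (hd : 1 ≤ d) : Submodule.span Kf (Cset d 1) = ⊤ := by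
  rw [← wordSpan_eq_top (d := d) (A := ⊥) le_rfl (by omega) (by omega) (by omega), eq_comm]
  refine le_antisymm (Submodule.span_le.2 ?_) ?_
  · rintro _ ⟨a, ha, j, m, c, hj, hjn, hc, rfl⟩
    obtain ⟨r, rfl⟩ := Algebra.mem_bot.1 ha
    rw [← Algebra.smul_def]
    refine Submodule.smul_mem _ _ (Submodule.subset_span
      ⟨fun _ => gRange d 1 j 1 * (c * tY d 1 j ^ m), fun i => ?_, by simp⟩)
    obtain rfl : i = 0 := Subsingleton.elim _ _
    exact word_mem_Mset hd m hj hjn le_rfl hc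
  · rw [wordSpan_eq_top le_rfl (by omega) (by omega) (by omega)]; exact le_top

theorem IsIncl.span_Cset_succ (hd : 1 ≤ d) (hn : 1 ≤ n) (h : IsIncl d n inc)
    (hC : Submodule.span Kf (Cset d n) = ⊤) : Submodule.span Kf (Cset d (n + 1)) = ⊤ := by
  rw [eq_top_iff, ← wordSpan_eq_top (d := d) (A := inc.range) (by omega)
    (fun _ => ⟨_, h.1⟩) (fun i hi hin => ⟨_, h.2.1 i hi (by omega)⟩)
    (fun i hi hin => ⟨_, h.2.2 i hi (by omega)⟩)]
  refine Submodule.span_le.2 ?_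
  rintro _ ⟨_, ⟨a, rfl⟩, j, m, c, hj, hjn, hc, rfl⟩
  have ha : a ∈ Submodule.span Kf (Cset d n) := hC ▸ Submodule.mem_top
  have hw := word_mem_Mset hd m hj hjn le_rfl hc
  change inc a * _ ∈ _
  refine Submodule.span_induction ?_ ?_ ?_ ?_ ha
  · exact fun x hx => Submodule.subset_span (h.map_mul_mem_Cset hx hw)
  · rw [map_zero, zero_mul]; exact zero_mem _
  · intro x y _ _ hx hy
    rw [map_add, add_mul]; exact add_mem hx hy
  · intro r x _ hx
    rw [map_smul, smul_mul_assoc]; exact Submodule.smul_mem _ r hx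

end StandardBasis

/-- The set `𝖢_n` spans `Y_{d,n}^B` for `n ≥ 1`. -/
theorem span_Cset {d : ℕ} (hd : 1 ≤ d) {inc : (k : ℕ) → (YB d k →ₐ[Kf] YB d (k + 1))}
    (hinc : ∀ k, 1 ≤ k → IsIncl d k (inc k)) {n : ℕ} (hn : 1 ≤ n) :
    Submodule.span Kf (Cset d n) = ⊤ := by
  induction n, hn using Nat.le_induction with
  | base => exact span_Cset_one hd
  | succ n hn ih => exact (hinc n hn).span_Cset_succ hd hn ih

section Trace

variable {d : ℕ} {x y : ZMod d → Kf}

section RelTrace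

variable {n : ℕ} {inc : YB d n →ₐ[Kf] YB d (n + 1)} {tr : YB d (n + 1) →ₗ[Kf] YB d n}

theorem map_mul_eq_smul_of_span (hC : Submodule.span Kf (Cset d n) = ⊤) {z : YB d (n + 1)}
    {r : Kf} (h : ∀ w ∈ Cset d n, tr (inc w * z) = r • w) (w : YB d n) :
    tr (inc w * z) = r • w := by
  have hw : w ∈ Submodule.span Kf (Cset d n) := hC ▸ Submodule.mem_top
  refine Submodule.span_induction h ?_ ?_ ?_ hw
  · rw [map_zero, zero_mul, map_zero, smul_zero]
  · intro a b _ _ ha hb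
    rw [map_add, add_mul, map_add, ha, hb, smul_add]
  · intro s a _ ha
    rw [map_smul, smul_mul_assoc, map_smul, ha, smul_comm]

theorem IsRelTrace.map_mul_tY_pow (hd : 1 ≤ d) (hC : Submodule.span Kf (Cset d n) = ⊤)
    (htr : IsRelTrace d x y n inc tr) (w : YB d n) (m : ℕ) :
    tr (inc w * tY d (n + 1) (n + 1) ^ m) = x (m : ZMod d) • w := by
  rw [← tY_pow_mod, ← ZMod.natCast_mod m d]
  exact map_mul_eq_smul_of_span hC
    (fun w hw => (htr w hw _ (Nat.le_sub_one_of_lt (Nat.mod_lt m hd))).1) w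

theorem IsRelTrace.map_mul_bk_mul_tY_pow (hd : 1 ≤ d)
    (hC : Submodule.span Kf (Cset d n) = ⊤)
    (htr : IsRelTrace d x y n inc tr) (w : YB d n) (m : ℕ) :
    tr (inc w * (bk d (n + 1) (n + 1) * tY d (n + 1) (n + 1) ^ m)) = y (m : ZMod d) • w := by
  rw [← tY_pow_mod, ← ZMod.natCast_mod m d]
  exact map_mul_eq_smul_of_span hC
    (fun w hw => (htr w hw _ (Nat.le_sub_one_of_lt (Nat.mod_lt m hd))).2.1) w

theorem IsRelTrace.map_mul_eGen (hd : 1 ≤ d) (hn : 1 ≤ n)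
    (hC : Submodule.span Kf (Cset d n) = ⊤) (hinc : IsIncl d n inc)
    (htr : IsRelTrace d x y n inc tr) (w : YB d n) (m : ℕ) :
    tr (inc w * eGen d (n + 1) n m) = (d : Kf)⁻¹ •
      ∑ s ∈ Finset.range d, x (((d - s : ℕ) : ZMod d)) • (w * tY d n n ^ (m + s)) := by
  rw [eGen, mul_smul_comm, map_smul, Finset.mul_sum, map_sum]
  congr 1
  refine Finset.sum_congr rfl fun s _ => ?_
  rw [← htr.map_mul_tY_pow hd hC, map_mul inc, map_pow inc, hinc.2.2 n hn le_rfl,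
    mul_assoc]

end RelTrace

theorem eY_eq_eGen (n i : ℕ) : eY d n i = eGen d n i 0 := by
  simp only [eY_eq, eGen, zero_add]

theorem IsTr1.map_tY_pow (hd : 1 ≤ d) {tr1 : YB d 1 →ₗ[Kf] Kf} (h : IsTr1 d x y tr1) (m : ℕ) :
    tr1 (tY d 1 1 ^ m) = x (m : ZMod d) := by
  rw [← tY_pow_mod, ← ZMod.natCast_mod m d]
  exact (h _ (Nat.le_sub_one_of_lt (Nat.mod_lt m hd))).1

theorem IsTr1.map_bY_mul_tY_pow (hd : 1 ≤ d) {tr1 : YB d 1 →ₗ[Kf] Kf} (h : IsTr1 d x y tr1)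
    (m : ℕ) : tr1 (bY d 1 * tY d 1 1 ^ m) = y (m : ZMod d) := by
  rw [← tY_pow_mod, ← ZMod.natCast_mod m d]
  exact (h _ (Nat.le_sub_one_of_lt (Nat.mod_lt m hd))).2

/-- If `Tr_n(v t_n^j) = a_j C` for all `j`, then multiplication by `e_n^{(m)}` rescales
`Tr_n(v t_n^k)` by `F^{(k+m)} / a_k`, where `F` is formed from `x` and `a`. -/
theorem TrT_mul_eGen (hd : 1 ≤ d) {inc : (k : ℕ) → (YB d k →ₐ[Kf] YB d (k + 1))}
    (hinc : ∀ k, 1 ≤ k → IsIncl d k (inc k)) (tr1 : YB d 1 →ₗ[Kf] Kf)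
    {tr : (k : ℕ) → (YB d (k + 2) →ₗ[Kf] YB d (k + 1))}
    (htr : ∀ k, IsRelTrace d x y (k + 1) (inc (k + 1)) (tr k)) {p : ℕ} {v : YB d (p + 1)}
    {a : ZMod d → Kf} (ha : ∀ i, a i ≠ 0) {C : Kf}
    (hv : ∀ j : ℕ, TrT d tr1 tr p (v * tY d (p + 1) (p + 1) ^ j) = a (j : ZMod d) * C)
    (k m : ℕ) :
    TrT d tr1 tr (p + 1)
        (inc (p + 1) (v * tY d (p + 1) (p + 1) ^ k) * eGen d (p + 2) (p + 1) m) =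
      (Fcoef d x a ((k : ZMod d) + (m : ZMod d)) / a (k : ZMod d)) *
        TrT d tr1 tr p (v * tY d (p + 1) (p + 1) ^ k) := by
  have hC := span_Cset hd hinc (n := p + 1) (by omega)
  rw [hv k, ← mul_assoc, div_mul_cancel₀ _ (ha _)]
  change TrT d tr1 tr p (tr p _) = _
  rw [(htr p).map_mul_eGen hd (by omega) hC (hinc _ (by omega)), map_smul, map_sum, Fcoef,
    smul_eq_mul, mul_assoc, Finset.sum_mul]
  congr 1
  refine Finset.sum_congr rfl fun s _ => ?_
  rw [map_smul, smul_eq_mul, mul_assoc v, ← pow_add, hv]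
  push_cast
  rw [add_assoc, mul_assoc]

theorem Ecoef_eq_Fcoef (j : ZMod d) : Ecoef d x j = Fcoef d x x j := by
  simp only [Ecoef, Fcoef, mul_comm]

end Trace

/-- for `w = w' t_n^k` with `w' ∈ Y_{d,n-1}^B`,
`Tr_{n+1}(w e_n^{(m)}) = (E^{(k+m)}/x_k) Tr_n(w)`; in particular
`Tr_{n+1}(w e_n) = (E^{(k)}/x_k) Tr_n(w)`. Similarly, for `w = w' b_n t_n^k`,
`Tr_{n+1}(w e_n^{(m)}) = (F^{(k+m)}/y_k) Tr_n(w)` and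
`Tr_{n+1}(w e_n) = (F^{(k)}/y_k) Tr_n(w)`. The first two conjuncts treat `n ≥ 2`
(with `n = p + 1` and `w' ∈ Y_{d,p}^B`), and the last two treat `n = 1`
(where `w' = c` is a scalar, `Y_{d,0}^B = L`). -/
theorem stmt19 (d : ℕ) (hd : 1 ≤ d)
    (x y : ZMod d → Kf) (hx0 : x 0 = 1) (hx : ∀ i, x i ≠ 0) (hy : ∀ i, y i ≠ 0)
    (inc : (k : ℕ) → (YB d k →ₐ[Kf] YB d (k + 1))) (hinc : ∀ k, 1 ≤ k → IsIncl d k (inc k))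
    (tr1 : YB d 1 →ₗ[Kf] Kf) (htr1 : IsTr1 d x y tr1)
    (tr : (k : ℕ) → (YB d (k + 2) →ₗ[Kf] YB d (k + 1)))
    (htr : ∀ k, IsRelTrace d x y (k + 1) (inc (k + 1)) (tr k)) :
    (∀ (p : ℕ), 1 ≤ p → ∀ (w' : YB d p) (k m : ℕ), k ≤ d - 1 → m ≤ d - 1 →
      (TrT d tr1 tr (p + 1)
          (inc (p + 1) (inc p w' * tY d (p + 1) (p + 1) ^ k) * eGen d (p + 2) (p + 1) m) =
        (Ecoef d x ((k : ZMod d) + (m : ZMod d)) / x (k : ZMod d)) *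
          TrT d tr1 tr p (inc p w' * tY d (p + 1) (p + 1) ^ k)) ∧
      (TrT d tr1 tr (p + 1)
          (inc (p + 1) (inc p w' * tY d (p + 1) (p + 1) ^ k) * eY d (p + 2) (p + 1)) =
        (Ecoef d x (k : ZMod d) / x (k : ZMod d)) *
          TrT d tr1 tr p (inc p w' * tY d (p + 1) (p + 1) ^ k))) ∧
    (∀ (p : ℕ), 1 ≤ p → ∀ (w' : YB d p) (k m : ℕ), k ≤ d - 1 → m ≤ d - 1 →
      (TrT d tr1 tr (p + 1)
          (inc (p + 1) (inc p w' * (bk d (p + 1) (p + 1) * tY d (p + 1) (p + 1) ^ k)) *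
            eGen d (p + 2) (p + 1) m) =
        (Fcoef d x y ((k : ZMod d) + (m : ZMod d)) / y (k : ZMod d)) *
          TrT d tr1 tr p (inc p w' * (bk d (p + 1) (p + 1) * tY d (p + 1) (p + 1) ^ k))) ∧
      (TrT d tr1 tr (p + 1)
          (inc (p + 1) (inc p w' * (bk d (p + 1) (p + 1) * tY d (p + 1) (p + 1) ^ k)) *
            eY d (p + 2) (p + 1)) =
        (Fcoef d x y (k : ZMod d) / y (k : ZMod d)) *
          TrT d tr1 tr p (inc p w' * (bk d (p + 1) (p + 1) * tY d (p + 1) (p + 1) ^ k)))) ∧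
    (∀ (c : Kf) (k m : ℕ), k ≤ d - 1 → m ≤ d - 1 →
      (TrT d tr1 tr 1 (inc 1 (c • tY d 1 1 ^ k) * eGen d 2 1 m) =
        (Ecoef d x ((k : ZMod d) + (m : ZMod d)) / x (k : ZMod d)) *
          TrT d tr1 tr 0 (c • tY d 1 1 ^ k)) ∧
      (TrT d tr1 tr 1 (inc 1 (c • tY d 1 1 ^ k) * eY d 2 1) =
        (Ecoef d x (k : ZMod d) / x (k : ZMod d)) * TrT d tr1 tr 0 (c • tY d 1 1 ^ k))) ∧
    (∀ (c : Kf) (k m : ℕ), k ≤ d - 1 → m ≤ d - 1 →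
      (TrT d tr1 tr 1 (inc 1 (c • (bY d 1 * tY d 1 1 ^ k)) * eGen d 2 1 m) =
        (Fcoef d x y ((k : ZMod d) + (m : ZMod d)) / y (k : ZMod d)) *
          TrT d tr1 tr 0 (c • (bY d 1 * tY d 1 1 ^ k))) ∧
      (TrT d tr1 tr 1 (inc 1 (c • (bY d 1 * tY d 1 1 ^ k)) * eY d 2 1) =
        (Fcoef d x y (k : ZMod d) / y (k : ZMod d)) *
          TrT d tr1 tr 0 (c • (bY d 1 * tY d 1 1 ^ k)))) := by
  have hC : ∀ q, Submodule.span Kf (Cset d (q + 1)) = ⊤ :=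
    fun q => span_Cset hd hinc (by omega)
  simp only [Ecoef_eq_Fcoef, eY_eq_eGen]
  refine ⟨fun p hp w' k m _ _ => ?_, fun p hp w' k m _ _ => ?_, fun c k m _ _ => ?_,
    fun c k m _ _ => ?_⟩
  · obtain ⟨q, rfl⟩ := Nat.exists_eq_add_of_le' hp
    have h := TrT_mul_eGen hd hinc tr1 htr (p := q + 1) (v := inc (q + 1) w') hx
      (C := TrT d tr1 tr q w') fun j => by
        change TrT d tr1 tr q (tr q _) = _
        rw [(htr q).map_mul_tY_pow hd (hC q), map_smul, smul_eq_mul]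
    exact ⟨h k m, by simpa only [Nat.cast_zero, add_zero] using h k 0⟩
  · obtain ⟨q, rfl⟩ := Nat.exists_eq_add_of_le' hp
    have h := TrT_mul_eGen hd hinc tr1 htr (p := q + 1)
      (v := inc (q + 1) w' * bk d (q + 1 + 1) (q + 1 + 1)) hy
      (C := TrT d tr1 tr q w') fun j => by
        change TrT d tr1 tr q (tr q _) = _
        rw [mul_assoc, (htr q).map_mul_bk_mul_tY_pow hd (hC q), map_smul, smul_eq_mul]
    simp only [← mul_assoc (inc (q + 1) w')]
    exact ⟨h k m, by simpa only [Nat.cast_zero, add_zero] using h k 0⟩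
  · have h := TrT_mul_eGen hd hinc tr1 htr (p := 0) (v := c • (1 : YB d 1)) hx
      (C := c) fun j => by
        change tr1 _ = _
        rw [smul_mul_assoc, one_mul, map_smul, htr1.map_tY_pow hd, smul_eq_mul, mul_comm]
    simp only [smul_mul_assoc, one_mul] at h
    exact ⟨h k m, by simpa only [Nat.cast_zero, add_zero] using h k 0⟩
  · have h := TrT_mul_eGen hd hinc tr1 htr (p := 0) (v := c • bY d 1) hy
      (C := c) fun j => by
        change tr1 _ = _
        rw [smul_mul_assoc, map_smul, htr1.map_bY_mul_tY_pow hd, smul_eq_mul, mul_comm]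
    simp only [smul_mul_assoc] at h
    exact ⟨h k m, by simpa only [Nat.cast_zero, add_zero] using h k 0⟩
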